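/- In a finitely generated free group F, for any finitely generated subgroups H₁, H₂ and any g ∈ F, the double coset H₁ g H₂ is separable, i.e., closed in the profinite topology on F. -/

import Mathlib

/-- A partial injection of a finite type preserving a colouring extends to a permutation
preserving the colouring. -/
theorem aux_extend {T C : Type} [Finite T] (c : T → C) (D : Set T) (f : T → T)
    (hf : Set.InjOn f D) (hc : ∀ t ∈ D, c (f t) = c t) :
    ∃ σ : Equiv.Perm T, (∀ t ∈ D, σ t = f t) ∧ ∀ t, c (σ t) = c t := by
  classical
  have key : ∀ o : C, ∃ τ : Equiv.Perm {t // c t = o},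
      ∀ t : {t // c t = o}, t.1 ∈ D → (τ t).1 = f t.1 := by
    intro o
    have : Fintype {t // c t = o} := Fintype.ofFinite _
    let f' : {t // c t = o} → {t // c t = o} :=
      fun t => if h : t.1 ∈ D then ⟨f t.1, (hc _ h).trans t.2⟩ else t
    let D' : Finset {t // c t = o} := Finset.univ.filter (fun t => t.1 ∈ D)
    have hinj : Set.InjOn f' (D' : Set {t // c t = o}) := by
      intro s hs t ht hst
      have hs' : s.1 ∈ D := by simpa [D'] using hs
      have ht' : t.1 ∈ D := by simpa [D'] using ht
      simp only [f', hs', ht', dif_pos, Subtype.mk.injEq] at hst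
      exact Subtype.ext (hf hs' ht' hst)
    obtain ⟨τ, hτ⟩ := Finset.exists_equiv_extend_of_card_eq (t := Finset.univ) (s := D') (f := f')
      (by simp) (by simp) hinj
    refine ⟨τ.trans (Equiv.subtypeUnivEquiv (by simp)), ?_⟩
    intro t ht
    have := hτ t (by simpa [D'] using ht)
    simp [Equiv.subtypeUnivEquiv, this, f', ht]
  choose τ hτ using key
  have hcol : ∀ t, c (τ (c t) ⟨t, rfl⟩).1 = c t := fun t => (τ (c t) ⟨t, rfl⟩).2
  have hinj : Function.Injective (fun t => (τ (c t) ⟨t, rfl⟩).1) := by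
    intro s t hst
    have h1 : c s = c t := by
      rw [← hcol s, ← hcol t]; exact congrArg c hst
    have h2 : ∀ (o : C) (hs : c s = o) (ht : c t = o),
        (τ o ⟨s, hs⟩).1 = (τ o ⟨t, ht⟩).1 → s = t := by
      intro o hs ht h
      have := (τ o).injective (Subtype.ext h)
      exact congrArg Subtype.val this
    refine h2 (c t) h1 rfl ?_
    have h3 : ∀ (o : C) (hs : c s = o), (τ o ⟨s, hs⟩).1 = (τ (c s) ⟨s, rfl⟩).1 := by
      rintro o rfl; rfl
    rw [h3]; exact hst
  refine ⟨Equiv.ofBijective _ (Finite.injective_iff_bijective.1 hinj), ?_, ?_⟩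
  · intro t ht
    exact hτ _ _ ht
  · intro t
    exact hcol t

/-- Tracing a word whose suffixes stay inside `U`. -/
theorem aux_trace {α X Z : Type} [MulAction (FreeGroup α) X] (Φ : FreeGroup α →* Equiv.Perm Z)
    (U : Set X) (R : X → Z → Prop)
    (hR : ∀ a u z, u ∈ U → FreeGroup.of a • u ∈ U →
      (R u z ↔ R (FreeGroup.of a • u) (Φ (FreeGroup.of a) z)))
    (u : X) (L : List (α × Bool)) (hL : ∀ L', L' <:+ L → FreeGroup.mk L' • u ∈ U) (z : Z) :
    R u z ↔ R (FreeGroup.mk L • u) (Φ (FreeGroup.mk L) z) := by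
  induction L with
  | nil =>
    rw [← FreeGroup.one_eq_mk]; simp
  | cons b L ih =>
    have h1 := hL _ List.suffix_rfl
    have h2 := hL L (List.suffix_cons b L)
    rw [ih (fun L' h => hL L' (h.trans (List.suffix_cons b L)))]
    obtain ⟨a, b⟩ := b
    have hb : FreeGroup.mk ((a, b) :: L) = FreeGroup.mk [(a, b)] * FreeGroup.mk L := by
      simp
    rw [hb, mul_smul] at h1
    rw [hb, mul_smul, map_mul, Equiv.Perm.mul_apply]
    cases b with
    | true => exact hR a _ _ h2 h1
    | false =>
      have hi : FreeGroup.mk [(a, false)] = (FreeGroup.of a)⁻¹ := by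
        rfl
      rw [hi] at h1 ⊢
      have := hR a ((FreeGroup.of a)⁻¹ • FreeGroup.mk L • u)
        (Φ (FreeGroup.of a)⁻¹ (Φ (FreeGroup.mk L) z)) h1 (by simpa using h2)
      rw [this]
      simp

theorem aux_trace_subgroup {α X Z : Type} [DecidableEq α] [MulAction (FreeGroup α) X]
    (Φ : FreeGroup α →* Equiv.Perm Z)
    (U : Set X) (R : X → Z → Prop)
    (hR : ∀ a u z, u ∈ U → FreeGroup.of a • u ∈ U →
      (R u z ↔ R (FreeGroup.of a • u) (Φ (FreeGroup.of a) z)))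
    (u : X) (S : Set (FreeGroup α)) (hfix : ∀ s ∈ S, s • u = u)
    (hS : ∀ s ∈ S, ∀ L', L' <:+ s.toWord → FreeGroup.mk L' • u ∈ U)
    (h : FreeGroup α) (hh : h ∈ Subgroup.closure S) : ∀ z, R u z ↔ R u (Φ h z) := by
  induction hh using Subgroup.closure_induction with
  | mem s hs =>
    intro z
    have := aux_trace Φ U R hR u s.toWord (hS s hs) z
    rwa [FreeGroup.mk_toWord, hfix s hs] at this
  | one => simp
  | mul x y _ _ hx hy =>
    intro z
    rw [hy z, hx, map_mul, Equiv.Perm.mul_apply]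
  | inv x _ hx =>
    intro z
    rw [hx (Φ x⁻¹ z)]
    simp

theorem aux_finite {α X : Type} [DecidableEq α] [MulAction (FreeGroup α) X] (u : X) (S : Set (FreeGroup α))
    (hS : S.Finite) : ∃ U : Set X, U.Finite ∧ u ∈ U ∧
      ∀ s ∈ S, ∀ L', L' <:+ s.toWord → FreeGroup.mk L' • u ∈ U := by
  refine ⟨insert u (⋃ s ∈ S, (fun L' => FreeGroup.mk L' • u) '' {L' | L' ∈ s.toWord.tails}),
    ?_, Set.mem_insert _ _, ?_⟩
  · refine Set.Finite.insert _ (hS.biUnion fun s _ => Set.Finite.image _ ?_)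
    exact List.finite_toSet _
  · intro s hs L' hL'
    refine Set.mem_insert_of_mem _ (Set.mem_biUnion hs ⟨L', ?_, rfl⟩)
    simpa using hL'

/-- The main case: a product `K * H` of two finitely generated subgroups. -/
theorem aux_main {α : Type} (K H : Subgroup (FreeGroup α)) (hK : K.FG) (hH : H.FG)
    (x : FreeGroup α) (hx : ∀ k ∈ K, ∀ h ∈ H, x ≠ k * h) :
    ∃ (Q : Type) (_ : Group Q) (_ : Finite Q) (φ : FreeGroup α →* Q),
      ∀ k ∈ K, ∀ h ∈ H, φ x ≠ φ k * φ h := by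
  classical
  obtain ⟨SK, rfl⟩ := hK
  obtain ⟨SH, rfl⟩ := hH
  set K := Subgroup.closure (SK : Set (FreeGroup α)) with hKdef
  set H := Subgroup.closure (SH : Set (FreeGroup α)) with hHdef
  let X := FreeGroup α ⧸ H
  let Y := FreeGroup α ⧸ K
  let u0 : X := ((1 : FreeGroup α) : FreeGroup α ⧸ H)
  let y0 : Y := ((1 : FreeGroup α) : FreeGroup α ⧸ K)
  have hu0 : ∀ g : FreeGroup α, g • u0 = u0 ↔ g ∈ H := by
    intro g
    have e : g • u0 = ((g * 1 : FreeGroup α) : FreeGroup α ⧸ H) := rfl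
    rw [e, eq_comm, QuotientGroup.eq]; simp
  have hy0 : ∀ g : FreeGroup α, g • y0 = y0 ↔ g ∈ K := by
    intro g
    have e : g • y0 = ((g * 1 : FreeGroup α) : FreeGroup α ⧸ K) := rfl
    rw [e, eq_comm, QuotientGroup.eq]; simp
  obtain ⟨U, hUf, hU0, hU⟩ := aux_finite u0 (insert x (SH : Set (FreeGroup α)))
    (SH.finite_toSet.insert x)
  obtain ⟨P, hPf, hP0, hP⟩ := aux_finite y0 (SK : Set (FreeGroup α)) SK.finite_toSet
  have : Finite U := hUf
  have : Finite P := hPf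
  -- permutations of `P`
  have hρ : ∀ a : α, ∃ ρ : Equiv.Perm P,
      ∀ p : P, FreeGroup.of a • p.1 ∈ P → (ρ p).1 = FreeGroup.of a • p.1 := by
    intro a
    obtain ⟨ρ, h1, -⟩ := aux_extend (fun _ : P => ()) {p | FreeGroup.of a • p.1 ∈ P}
      (fun p => if h : FreeGroup.of a • p.1 ∈ P then ⟨_, h⟩ else p)
      (by
        intro p hp q hq hpq
        simp only [Set.mem_ofPred_eq] at hp hq
        simp only [hp, hq, dif_pos, Subtype.mk.injEq] at hpq
        exact Subtype.ext (MulAction.injective _ hpq))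
      (fun _ _ => rfl)
    refine ⟨ρ, fun p hp => ?_⟩
    rw [h1 p hp]; simp [hp]
  choose ρ hρ using hρ
  let c : U × P → Quotient (MulAction.orbitRel (FreeGroup α) (X × Y)) :=
    fun t => Quotient.mk _ ((t.1.1, t.2.1) : X × Y)
  have hcs : ∀ (g : FreeGroup α) (s t : U × P), s.1.1 = g • t.1.1 → s.2.1 = g • t.2.1 →
      c s = c t := by
    intro g s t h1 h2
    refine Quotient.sound ?_
    refine MulAction.orbitRel_apply.2 ⟨g, ?_⟩
    exact Prod.ext h1.symm h2.symm
  have hσ : ∀ (a : α) (p : P), ∃ σ : Equiv.Perm (U × P),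
      (∀ u : U, ∀ h : FreeGroup.of a • u.1 ∈ U, σ (u, p) = (⟨_, h⟩, ρ a p)) ∧
      (FreeGroup.of a • p.1 ∈ P → ∀ t, c (σ t) = c t) := by
    intro a p
    let D : Set (U × P) := {t | t.2 = p ∧ FreeGroup.of a • t.1.1 ∈ U}
    let f : U × P → U × P :=
      fun t => if h : FreeGroup.of a • t.1.1 ∈ U then (⟨_, h⟩, ρ a p) else t
    have hinj : Set.InjOn f D := by
      rintro ⟨u, q⟩ ⟨rfl, hu⟩ ⟨v, q'⟩ ⟨rfl, hv⟩ huv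
      simp only at hu hv
      simp only [f, hu, hv, dif_pos, Prod.mk.injEq, Subtype.mk.injEq, and_true] at huv
      rw [Subtype.ext (MulAction.injective _ huv)]
    by_cases hp : FreeGroup.of a • p.1 ∈ P
    · obtain ⟨σ, h1, h2⟩ := aux_extend c D f hinj (by
        rintro ⟨u, q⟩ ⟨rfl, hu⟩
        simp only at hu
        refine hcs (FreeGroup.of a) _ _ ?_ ?_
        · simp [f, hu]
        · simp only [f, hu, dif_pos]; exact hρ a q hp)
      refine ⟨σ, fun u h => ?_, fun _ => h2⟩
      rw [h1 (u, p) ⟨rfl, h⟩]; simp [f, h]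
    · obtain ⟨σ, h1, -⟩ := aux_extend (fun _ => ()) D f hinj (fun _ _ => rfl)
      refine ⟨σ, fun u h => ?_, fun h => absurd h hp⟩
      rw [h1 (u, p) ⟨rfl, h⟩]; simp [f, h]
  choose σ hσ1 hσ2 using hσ
  let M : α → Equiv.Perm (P × (U × P)) := fun a =>
    { toFun := fun z => (ρ a z.1, σ a z.1 z.2)
      invFun := fun z => ((ρ a).symm z.1, (σ a ((ρ a).symm z.1)).symm z.2)
      left_inv := fun z => by simp
      right_inv := fun z => by simp }
  let Φ : FreeGroup α →* Equiv.Perm (P × (U × P)) := FreeGroup.lift M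
  have hΦ : ∀ a z, Φ (FreeGroup.of a) z = (ρ a z.1, σ a z.1 z.2) := by
    intro a z; simp [Φ, M]
  -- first tracing relation
  let R1 : X → P × (U × P) → Prop := fun u z => z.2.1.1 = u ∧ z.2.2 = z.1
  have hR1 : ∀ a u z, u ∈ U → FreeGroup.of a • u ∈ U →
      (R1 u z ↔ R1 (FreeGroup.of a • u) (Φ (FreeGroup.of a) z)) := by
    rintro a u ⟨p, t⟩ hu hau
    have e := hσ1 a p ⟨u, hu⟩ hau
    have l : R1 u (p, t) ↔ t = (⟨u, hu⟩, p) := by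
      simp only [R1, Prod.ext_iff, Subtype.ext_iff]
    have r : R1 (FreeGroup.of a • u) (Φ (FreeGroup.of a) (p, t)) ↔
        σ a p t = (⟨_, hau⟩, ρ a p) := by
      rw [hΦ]; simp only [R1, Prod.ext_iff, Subtype.ext_iff]
    rw [l, r, ← e, (σ a p).injective.eq_iff]
  -- second tracing relation
  let c0 := c (⟨u0, hU0⟩, ⟨y0, hP0⟩)
  let R2 : Y → P × (U × P) → Prop := fun y z => z.1.1 = y ∧ c z.2 = c0
  have hR2 : ∀ a y z, y ∈ P → FreeGroup.of a • y ∈ P →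
      (R2 y z ↔ R2 (FreeGroup.of a • y) (Φ (FreeGroup.of a) z)) := by
    rintro a y ⟨p, t⟩ hy hay
    rw [hΦ]
    simp only [R2]
    have e := hρ a ⟨y, hy⟩ hay
    constructor
    · rintro ⟨rfl, h⟩
      exact ⟨e, by rw [hσ2 a p hay]; exact h⟩
    · rintro ⟨h1, h2⟩
      rw [← e] at h1
      have := (ρ a).injective (Subtype.ext h1)
      subst this
      refine ⟨rfl, ?_⟩
      rwa [hσ2 a _ hay] at h2
  refine ⟨Equiv.Perm (P × (U × P)), inferInstance, inferInstance, Φ, ?_⟩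
  intro k hk h hh heq
  -- choose a start point whose image under `h` lies over the base point
  have t1 := aux_trace_subgroup Φ U R1 hR1 u0 (SH : Set (FreeGroup α))
    (fun s hs => (hu0 s).2 (Subgroup.subset_closure hs))
    (fun s hs => hU s (Set.mem_insert_of_mem _ hs)) h hh
  have t2 := aux_trace_subgroup Φ P R2 hR2 y0 (SK : Set (FreeGroup α))
    (fun s hs => (hy0 s).2 (Subgroup.subset_closure hs)) hP k hk
  let w : P × (U × P) := (⟨y0, hP0⟩, (⟨u0, hU0⟩, ⟨y0, hP0⟩))
  let z := Φ h⁻¹ w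
  have hz : Φ h z = w := by simp [z]
  have r1 : R1 u0 z := by
    rw [t1 z, hz]; exact ⟨rfl, rfl⟩
  have r2 := (aux_trace Φ U R1 hR1 u0 x.toWord (hU x (Set.mem_insert _ _)) z).1 r1
  rw [FreeGroup.mk_toWord, heq, Equiv.Perm.mul_apply, hz] at r2
  have r3 : R2 y0 (Φ k w) := (t2 w).1 ⟨rfl, rfl⟩
  obtain ⟨a1, a2⟩ := r2
  obtain ⟨b1, b2⟩ := r3
  have := Quotient.exact b2
  obtain ⟨g, hg⟩ := MulAction.orbitRel_apply.1 this
  have g1 : g • u0 = x • u0 := (congrArg Prod.fst hg).trans a1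
  have g2 : g • y0 = y0 := (congrArg Prod.snd hg).trans ((congrArg Subtype.val a2).trans b1)
  refine hx g ((hy0 g).1 g2) (g⁻¹ * x) ?_ (by group)
  rw [← hu0, mul_smul, ← g1, inv_smul_smul]

/-- In a finitely generated free group, double cosets of finitely generated
subgroups are separable. -/
theorem stmt5 {α : Type} [Finite α] (H₁ H₂ : Subgroup (FreeGroup α))
    (h₁ : H₁.FG) (h₂ : H₂.FG) (g : FreeGroup α) (x : FreeGroup α)
    (hx : x ∉ {y : FreeGroup α | ∃ a ∈ H₁, ∃ b ∈ H₂, y = a * g * b}) :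
    ∃ (Q : Type) (_ : Group Q) (_ : Finite Q) (φ : FreeGroup α →* Q),
      φ x ∉ φ '' {y : FreeGroup α | ∃ a ∈ H₁, ∃ b ∈ H₂, y = a * g * b} := by
  obtain ⟨Q, i1, i2, φ, hφ⟩ := aux_main H₁ (H₂.map (MulAut.conj g).toMonoidHom) h₁
    ((Subgroup.fg_iff _).2 (by
      obtain ⟨S, rfl⟩ := h₂
      exact ⟨_, (MonoidHom.map_closure _ _).symm, S.finite_toSet.image _⟩)) (x * g⁻¹) (by
      rintro k hk _ ⟨b, hb, rfl⟩ h
      refine hx ⟨k, hk, b, hb, ?_⟩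
      have := congrArg (· * g) h
      simpa [mul_assoc] using this)
  refine ⟨Q, i1, i2, φ, ?_⟩
  rintro ⟨_, ⟨a, ha, b, hb, rfl⟩, h⟩
  refine hφ a ha _ ⟨b, hb, rfl⟩ ?_
  rw [map_mul, ← h]
  simp [mul_assoc]
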